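/- Let k be an algebraically closed field, Λ a finite-dimensional associative unital k-algebra, K a field extension of k, and M a Λ-module that is finite-dimensional over k. If M is indecomposable, then the Λ_K-module M_K is indecomposable. -/

import Mathlib

open TensorProduct

section BaseChange

variable (k K Λ M : Type*)
variable [Field k] [Field K] [Algebra k K]
variable [Ring Λ] [Algebra k Λ]
variable [AddCommGroup M] [Module k M] [Module Λ M] [IsScalarTower k Λ M]

/-- The action of `K` on the right-hand tensor factor of `M_K = M ⊗_k K`,
as a ring homomorphism `K →+* End_k (M ⊗_k K)`. -/
noncomputable def rightSmulHom : K →+* Module.End k (M ⊗[k] K) where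
  toFun c := LinearMap.lTensor M (LinearMap.mulLeft k c)
  map_one' := by
    show LinearMap.lTensor M (LinearMap.mulLeft k (1 : K)) = 1
    rw [LinearMap.mulLeft_one, LinearMap.lTensor_id]; rfl
  map_mul' c d := by
    show LinearMap.lTensor M (LinearMap.mulLeft k (c * d)) =
      LinearMap.lTensor M (LinearMap.mulLeft k c) * LinearMap.lTensor M (LinearMap.mulLeft k d)
    rw [LinearMap.mulLeft_mul, LinearMap.lTensor_comp]; rfl
  map_zero' := by
    show LinearMap.lTensor M (LinearMap.mulLeft k (0 : K)) = 0
    rw [LinearMap.mulLeft_zero_eq_zero, LinearMap.lTensor_zero]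
  map_add' c d := by
    show LinearMap.lTensor M (LinearMap.mulLeft k (c + d)) =
      LinearMap.lTensor M (LinearMap.mulLeft k c) + LinearMap.lTensor M (LinearMap.mulLeft k d)
    rw [show LinearMap.mulLeft k (c + d) = LinearMap.mulLeft k c + LinearMap.mulLeft k d from
      LinearMap.ext fun x => add_mul c d x, LinearMap.lTensor_add]

/-- `M_K = M ⊗_k K` as a `K`-module (via the right-hand tensor factor). -/
noncomputable def modKMK : Module K (M ⊗[k] K) :=
  Module.compHom _ (rightSmulHom k K M)

/-- `M_K = M ⊗_k K` as a module over `Λ_K = Λ ⊗_k K`, with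
`(λ ⊗ a) • (m ⊗ b) = (λ • m) ⊗ (a*b)`. -/
noncomputable def modLamKMK : Module (Λ ⊗[k] K) (M ⊗[k] K) := by
  letI : Module K (M ⊗[k] K) := modKMK k K M
  haveI : IsScalarTower k K (M ⊗[k] K) := by
    constructor
    intro a c x
    induction x using TensorProduct.induction_on with
    | zero => simp only [smul_zero]
    | tmul m b =>
        show (LinearMap.lTensor M (LinearMap.mulLeft k (a • c))) (m ⊗ₜ[k] b) =
          a • (LinearMap.lTensor M (LinearMap.mulLeft k c)) (m ⊗ₜ[k] b)
        rw [LinearMap.lTensor_tmul, LinearMap.lTensor_tmul, LinearMap.mulLeft_apply,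
          LinearMap.mulLeft_apply, Algebra.smul_mul_assoc, tmul_smul]
    | add x y hx hy =>
        show (LinearMap.lTensor M (LinearMap.mulLeft k (a • c))) (x + y) = _
        rw [map_add]
        show _ = a • ((LinearMap.lTensor M (LinearMap.mulLeft k c)) (x + y))
        rw [map_add, smul_add]
        exact congrArg₂ (· + ·) hx hy
  haveI : SMulCommClass Λ K (M ⊗[k] K) := by
    constructor
    intro l c x
    show l • (LinearMap.lTensor M (LinearMap.mulLeft k c)) x =
      (LinearMap.lTensor M (LinearMap.mulLeft k c)) (l • x)
    induction x using TensorProduct.induction_on with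
    | zero => simp only [smul_zero, map_zero]
    | tmul m b =>
        rw [smul_tmul', LinearMap.lTensor_tmul, smul_tmul', LinearMap.lTensor_tmul]
    | add x y hx hy => rw [smul_add, map_add, map_add, smul_add, hx, hy]
  exact TensorProduct.Algebra.module

end BaseChange

/-- A module is indecomposable if it is nonzero and admits no nontrivial internal
direct sum decomposition `M = N₁ ⊕ N₂` into complementary submodules. -/
def IsIndecomposableModule (R : Type*) [Ring R] (M : Type*) [AddCommGroup M]
    [Module R M] : Prop :=
  (∃ m : M, m ≠ 0) ∧ ∀ N₁ N₂ : Submodule R M, IsCompl N₁ N₂ → N₁ = ⊥ ∨ N₂ = ⊥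

/-! ### Endomorphisms of an indecomposable module -/

namespace IsIndecomposableModule

/-- Fitting's lemma: a non-injective endomorphism of an indecomposable module of finite length
is nilpotent. -/
theorem isNilpotent_of_ker_ne_bot {R M : Type*} [Ring R] [AddCommGroup M] [Module R M]
    [IsArtinian R M] [IsNoetherian R M] (hM : IsIndecomposableModule R M)
    (g : Module.End R M) (hg : LinearMap.ker g ≠ ⊥) : IsNilpotent g := by
  obtain ⟨n, hn, hn1⟩ :=
    (g.eventually_isCompl_ker_pow_range_pow.and (Filter.eventually_ge_atTop 1)).exists
  refine ⟨n, ?_⟩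
  rcases hM.2 _ _ hn with h | h
  · refine absurd (eq_bot_iff.2 fun x hx => ?_) hg
    rw [← h, LinearMap.mem_ker]
    obtain ⟨m, rfl⟩ := Nat.exists_eq_add_of_le' hn1
    rw [pow_succ, Module.End.mul_apply, LinearMap.mem_ker.1 hx, map_zero]
  · exact LinearMap.range_eq_bot.1 h

theorem mem_jacobson_of_isNilpotent {R M : Type*} [Ring R] [AddCommGroup M] [Module R M]
    [IsArtinian R M] [IsNoetherian R M] (hM : IsIndecomposableModule R M)
    {f : Module.End R M} (hf : IsNilpotent f) : f ∈ Ring.jacobson (Module.End R M) := by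
  rw [← Ideal.jacobson_bot, Ideal.mem_jacobson_iff]
  intro y
  have hker : LinearMap.ker f ≠ ⊥ := fun h => by
    obtain ⟨n, hn⟩ := hf
    obtain ⟨m, hm⟩ := hM.1
    have hinj : Function.Injective (f ^ n) := by
      rw [Module.End.coe_pow]
      exact (LinearMap.ker_eq_bot.1 h).iterate n
    exact hm (hinj (by rw [hn]; simp))
  have hyf : IsNilpotent (y * f) := by
    refine hM.isNilpotent_of_ker_ne_bot _ fun h => hker (eq_bot_iff.2 ?_)
    rw [← h]
    exact LinearMap.ker_le_ker_comp f y
  obtain ⟨u, hu⟩ := hyf.isUnit_add_one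
  refine ⟨↑u⁻¹, ?_⟩
  have : (↑u⁻¹ : Module.End R M) * (y * f + 1) = 1 := by rw [← hu]; exact u.inv_mul
  rw [Ideal.mem_bot, mul_assoc, ← this, mul_add, mul_one]
  abel

/-- Over an algebraically closed field, every endomorphism of a finite-dimensional
indecomposable module is a scalar modulo the Jacobson radical. -/
theorem exists_sub_smul_one_mem_jacobson {k Λ M : Type*} [Field k] [IsAlgClosed k] [Ring Λ]
    [Algebra k Λ] [AddCommGroup M] [Module k M] [Module Λ M] [IsScalarTower k Λ M]
    [FiniteDimensional k M] (hM : IsIndecomposableModule Λ M) (f : Module.End Λ M) :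
    ∃ a : k, f - a • 1 ∈ Ring.jacobson (Module.End Λ M) := by
  have : Nontrivial M := nontrivial_of_ne _ _ hM.1.choose_spec
  have : IsNoetherian Λ M := isNoetherian_of_tower k inferInstance
  have : IsArtinian Λ M := isArtinian_of_tower k inferInstance
  obtain ⟨a, ha⟩ := Module.End.exists_eigenvalue (f.restrictScalars k)
  obtain ⟨v, hv⟩ := ha.exists_hasEigenvector
  refine ⟨a, hM.mem_jacobson_of_isNilpotent (hM.isNilpotent_of_ker_ne_bot _ fun h => hv.2 ?_)⟩
  rw [← Submodule.mem_bot Λ, ← h, LinearMap.mem_ker]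
  have := hv.apply_eq_smul
  simp only [LinearMap.restrictScalars_apply] at this
  simp [this]

end IsIndecomposableModule

theorem isNilpotent_jacobson_moduleEnd (k Λ M : Type*) [Field k] [Ring Λ]
    [Algebra k Λ] [AddCommGroup M] [Module k M] [Module Λ M] [IsScalarTower k Λ M]
    [FiniteDimensional k M] : IsNilpotent (Ring.jacobson (Module.End Λ M)) := by
  have : Module.Finite k (Module.End Λ M) :=
    .of_injective (LinearMap.restrictScalarsₗ k Λ M M k) (LinearMap.restrictScalars_injective k)
  have : IsArtinianRing (Module.End Λ M) := .of_finite k _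
  exact IsSemiprimaryRing.isNilpotent

/-! ### Endomorphisms of the base change -/

section BaseChangeEnd

variable {k K Λ M : Type*} [Field k] [Field K] [Algebra k K] [Ring Λ] [Algebra k Λ]
  [AddCommGroup M] [Module k M] [Module Λ M] [IsScalarTower k Λ M]
  [Module (Λ ⊗[k] K) (M ⊗[k] K)]

omit [Module Λ M] [IsScalarTower k Λ M] in
theorem one_tmul_smul_comm
    (c : K) (r : Λ ⊗[k] K) (x : M ⊗[k] K) :
    ((1 : Λ) ⊗ₜ[k] c) • r • x = r • ((1 : Λ) ⊗ₜ[k] c) • x := by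
  have : ((1 : Λ) ⊗ₜ[k] c) * r = r * ((1 : Λ) ⊗ₜ[k] c) := by
    induction r using TensorProduct.induction_on with
    | zero => simp
    | tmul l a => simp [mul_comm]
    | add r s hr hs => rw [mul_add, add_mul, hr, hs]
  rw [← mul_smul, ← mul_smul, this]

/-- An endomorphism of `M ⊗ K` is of the form `∑ fᵢ ⊗ bᵢ` with `fᵢ` endomorphisms of `M`. -/
theorem exists_end_tmul_one_eq_sum [FiniteDimensional k M]
    (hsmul : ∀ (l : Λ) (a : K) (m : M) (b : K), (l ⊗ₜ[k] a) • (m ⊗ₜ[k] b) = (l • m) ⊗ₜ[k] (a * b))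
    (e : Module.End (Λ ⊗[k] K) (M ⊗[k] K)) :
    ∃ (s : Finset K) (f : K → Module.End Λ M), ∀ m : M, e (m ⊗ₜ 1) = ∑ b ∈ s, f b m ⊗ₜ[k] b := by
  classical
  let B := Module.Basis.ofVectorSpace k K
  let φ := TensorProduct.equivFinsuppOfBasisRight (M := M) B
  have hφ (l : Λ) (x : M ⊗[k] K) (i) : φ ((l ⊗ₜ[k] (1 : K)) • x) i = l • φ x i := by
    induction x using TensorProduct.induction_on with
    | zero => simp
    | tmul m b =>
      simp [φ, hsmul, smul_comm l]
    | add x y hx hy => simp only [smul_add, map_add, Finsupp.add_apply, hx, hy]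
  let f (i) : Module.End Λ M :=
    { toFun := fun m => φ (e (m ⊗ₜ 1)) i
      map_add' := fun m n => by simp [add_tmul]
      map_smul' := fun l m => by
        rw [RingHom.id_apply, ← hφ, ← map_smul, hsmul, one_mul] }
  obtain ⟨S, hS⟩ := Module.Finite.fg_top (R := k) (M := M)
  let T := S.biUnion fun m => (φ (e (m ⊗ₜ 1))).support
  have hT (m : M) (i) (hi : i ∉ T) : f i m = 0 := by
    have hm : m ∈ Submodule.span k (S : Set M) := hS ▸ Submodule.mem_top
    have hle : Submodule.span k (S : Set M) ≤ LinearMap.ker ((f i).restrictScalars k) := by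
      refine Submodule.span_le.2 fun x hx => ?_
      by_contra h
      exact hi (Finset.mem_biUnion.2 ⟨x, hx, Finsupp.mem_support_iff.2 h⟩)
    exact hle hm
  refine ⟨T.map ⟨B, B.injective⟩, fun b => if h : ∃ i, B i = b then f h.choose else 0, fun m => ?_⟩
  have hch (i) (h : ∃ j, B j = B i) : h.choose = i := B.injective h.choose_spec
  rw [Finset.sum_map]
  have : e (m ⊗ₜ 1) = (φ (e (m ⊗ₜ 1))).sum fun i x => x ⊗ₜ[k] B i := by
    conv_lhs => rw [← φ.symm_apply_apply (e (m ⊗ₜ 1))]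
    exact TensorProduct.equivFinsuppOfBasisRight_symm_apply B _
  rw [this, Finsupp.sum_of_support_subset (s := T)]
  · refine Finset.sum_congr rfl fun i _ => ?_
    have h : ∃ j, B j = B i := ⟨i, rfl⟩
    simp only [Function.Embedding.coeFn_mk, dif_pos h, hch i h]
    rfl
  · intro i hi
    by_contra h
    exact Finsupp.mem_support_iff.1 hi (hT m i h)
  · intros
    exact zero_tmul _ _

variable (K) in
/-- The `Λ ⊗ K`-submodule `(I M) ⊗ K` of `M ⊗ K`, for a left ideal `I` of `End_Λ(M)`. -/
def idealTensor (I : Ideal (Module.End Λ M)) : Submodule (Λ ⊗[k] K) (M ⊗[k] K) :=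
  Submodule.span _ {x | ∃ j ∈ I, ∃ m : M, x = (j m) ⊗ₜ[k] (1 : K)}

omit [IsScalarTower k Λ M] in
theorem tmul_mem_idealTensor
    (hsmul : ∀ (l : Λ) (a : K) (m : M) (b : K), (l ⊗ₜ[k] a) • (m ⊗ₜ[k] b) = (l • m) ⊗ₜ[k] (a * b))
    {I : Ideal (Module.End Λ M)} {j : Module.End Λ M} (hj : j ∈ I) (m : M) (b : K) :
    (j m) ⊗ₜ[k] b ∈ idealTensor K I := by
  have := (idealTensor K I).smul_mem ((1 : Λ) ⊗ₜ[k] b) (Submodule.subset_span ⟨j, hj, m, rfl⟩)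
  rwa [hsmul, one_smul, mul_one] at this

/-- An endomorphism of `M ⊗ K` is a scalar in `K` modulo the radical of `End_Λ(M)`. -/
theorem exists_apply_sub_smul_mem_idealTensor [IsAlgClosed k] [FiniteDimensional k M]
    (hsmul : ∀ (l : Λ) (a : K) (m : M) (b : K), (l ⊗ₜ[k] a) • (m ⊗ₜ[k] b) = (l • m) ⊗ₜ[k] (a * b))
    (hM : IsIndecomposableModule Λ M) (e : Module.End (Λ ⊗[k] K) (M ⊗[k] K)) :
    ∃ c : K, ∀ (n : ℕ), ∀ x ∈ idealTensor K (Ring.jacobson (Module.End Λ M) ^ n),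
      e x - ((1 : Λ) ⊗ₜ[k] c) • x ∈ idealTensor K (Ring.jacobson (Module.End Λ M) ^ (n + 1)) := by
  obtain ⟨s, f, hf⟩ := exists_end_tmul_one_eq_sum hsmul e
  choose a ha using hM.exists_sub_smul_one_mem_jacobson (k := k)
  refine ⟨∑ b ∈ s, a (f b) • b, fun n x hx => ?_⟩
  induction hx using Submodule.span_induction with
  | mem x hx =>
    obtain ⟨j, hj, m, rfl⟩ := hx
    rw [hf, hsmul, one_smul, mul_one, tmul_sum, ← Finset.sum_sub_distrib]
    refine sum_mem fun b _ => ?_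
    have : f b (j m) ⊗ₜ[k] b - j m ⊗ₜ[k] (a (f b) • b) =
        ((f b - a (f b) • 1) * j) m ⊗ₜ[k] b := by
      simp [sub_tmul, sub_mul, smul_tmul]
    rw [this]
    refine tmul_mem_idealTensor hsmul ?_ m b
    rw [Ideal.IsTwoSided.pow_succ]
    exact Ideal.mul_mem_mul (ha _) hj
  | zero => simp
  | add x y _ _ hx hy =>
    rw [map_add, smul_add, add_sub_add_comm]
    exact add_mem hx hy
  | smul r x _ hx =>
    rw [map_smul, one_tmul_smul_comm, ← smul_sub]
    exact Submodule.smul_mem _ r hx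

/-- A submodule on which an endomorphism acts as a scalar other than its residue vanishes. -/
theorem eq_bot_of_apply_sub_smul_mem_idealTensor [FiniteDimensional k M]
    (hsmul : ∀ (l : Λ) (a : K) (m : M) (b : K), (l ⊗ₜ[k] a) • (m ⊗ₜ[k] b) = (l • m) ⊗ₜ[k] (a * b))
    {e : Module.End (Λ ⊗[k] K) (M ⊗[k] K)} {c d : K} (hcd : d ≠ c)
    (he : ∀ (n : ℕ), ∀ x ∈ idealTensor K (Ring.jacobson (Module.End Λ M) ^ n),
      e x - ((1 : Λ) ⊗ₜ[k] c) • x ∈ idealTensor K (Ring.jacobson (Module.End Λ M) ^ (n + 1)))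
    {N : Submodule (Λ ⊗[k] K) (M ⊗[k] K)} (hN : ∀ x ∈ N, e x = ((1 : Λ) ⊗ₜ[k] d) • x) :
    N = ⊥ := by
  have key (n : ℕ) : N ≤ idealTensor K (Ring.jacobson (Module.End Λ M) ^ n) := by
    induction n with
    | zero =>
      refine le_top.trans fun x _ => ?_
      induction x using TensorProduct.induction_on with
      | zero => exact zero_mem _
      | tmul m b =>
        exact tmul_mem_idealTensor hsmul (j := 1) (by simp [Submodule.pow_zero, Ideal.one_eq_top]) m b
      | add x y hx hy => exact add_mem (hx trivial) (hy trivial)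
    | succ n ih =>
      intro x hx
      have h := he n x (ih hx)
      rw [hN x hx, ← sub_smul, ← tmul_sub] at h
      have h' := Submodule.smul_mem _ ((1 : Λ) ⊗ₜ[k] (d - c)⁻¹) h
      rwa [← mul_smul, Algebra.TensorProduct.tmul_mul_tmul, mul_one,
        inv_mul_cancel₀ (sub_ne_zero.2 hcd), ← Algebra.TensorProduct.one_def, one_smul] at h'
  obtain ⟨n, hn⟩ := isNilpotent_jacobson_moduleEnd k Λ M
  refine eq_bot_iff.2 ((key n).trans (Submodule.span_le.2 ?_))
  rintro _ ⟨j, hj, m, rfl⟩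
  rw [hn] at hj
  simp [show j = 0 by simpa using hj]

end BaseChangeEnd

theorem IsIndecomposableModule.tensorProduct {k K Λ M : Type*}
    [Field k] [IsAlgClosed k] [Field K] [Algebra k K] [Ring Λ] [Algebra k Λ]
    [AddCommGroup M] [Module k M] [Module Λ M] [IsScalarTower k Λ M] [FiniteDimensional k M]
    [Module (Λ ⊗[k] K) (M ⊗[k] K)]
    (hsmul : ∀ (l : Λ) (a : K) (m : M) (b : K), (l ⊗ₜ[k] a) • (m ⊗ₜ[k] b) = (l • m) ⊗ₜ[k] (a * b))
    (hM : IsIndecomposableModule Λ M) : IsIndecomposableModule (Λ ⊗[k] K) (M ⊗[k] K) := by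
  refine ⟨?_, fun N₁ N₂ h => ?_⟩
  · have : Nontrivial M := nontrivial_of_ne _ _ hM.1.choose_spec
    exact exists_ne 0
  · obtain ⟨c, hc⟩ := exists_apply_sub_smul_mem_idealTensor hsmul hM (N₁.projection N₂ h)
    by_cases h1 : (1 : K) = c
    · right
      refine eq_bot_of_apply_sub_smul_mem_idealTensor hsmul (d := 0) (h1 ▸ zero_ne_one) hc ?_
      intro x hx
      rw [tmul_zero, zero_smul]
      exact (Submodule.projection_apply_eq_zero_iff h).2 hx
    · left
      refine eq_bot_of_apply_sub_smul_mem_idealTensor hsmul h1 hc fun x hx => ?_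
      rw [← Algebra.TensorProduct.one_def, one_smul]
      exact Submodule.projection_apply_of_mem_left h hx

/-- Lemma 2.1(1): let `k` be an algebraically closed field, `Λ` a finite-dimensional
`k`-algebra, `K : k` a field extension and `M` a finite-dimensional `Λ`-module.  If `M`
is indecomposable, then the `Λ_K`-module `M_K = M ⊗_k K` is indecomposable. -/
theorem statement8 (k K Λ M : Type*)
    [Field k] [IsAlgClosed k] [Field K] [Algebra k K]
    [Ring Λ] [Algebra k Λ] [FiniteDimensional k Λ]
    [AddCommGroup M] [Module k M] [Module Λ M] [IsScalarTower k Λ M]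
    [FiniteDimensional k M]
    (hM : IsIndecomposableModule Λ M) :
    letI : Module (Λ ⊗[k] K) (M ⊗[k] K) := modLamKMK k K Λ M
    IsIndecomposableModule (Λ ⊗[k] K) (M ⊗[k] K) := by
  exact @IsIndecomposableModule.tensorProduct k K Λ M _ _ _ _ _ _ _ _ _ _ _ (modLamKMK k K Λ M)
    (fun l a m b => rfl) hM
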